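/- The 1-cochain τ is a quasi-morphism: for all g, h ∈ G, |τ(g ∘ h) − τ(g) − τ(h)| ≤ π. -/

import Mathlib

open MeasureTheory

noncomputable section

/-- The closed unit disk in `ℝ²`. -/
def Disk : Set (ℝ × ℝ) := {p | p.1 ^ 2 + p.2 ^ 2 ≤ 1}

/-- The boundary circle `∂D` of the unit disk. -/
def Bdry : Set (ℝ × ℝ) := {p | p.1 ^ 2 + p.2 ^ 2 = 1}

/-- A symplectomorphism of the closed unit disk `D`: a bijection of `D` which, together
with its inverse, extends to a `C^∞` map on an open neighborhood of `D`, and whose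
Jacobian determinant equals `1` at every point of `D`. -/
structure SympD where
  toFun : ℝ × ℝ → ℝ × ℝ
  invFun : ℝ × ℝ → ℝ × ℝ
  mapsTo : Set.MapsTo toFun Disk Disk
  invMapsTo : Set.MapsTo invFun Disk Disk
  leftInv : ∀ p ∈ Disk, invFun (toFun p) = p
  rightInv : ∀ p ∈ Disk, toFun (invFun p) = p
  smooth : ∃ U : Set (ℝ × ℝ), IsOpen U ∧ Disk ⊆ U ∧ ContDiffOn ℝ (⊤ : ℕ∞) toFun U
  invSmooth : ∃ U : Set (ℝ × ℝ), IsOpen U ∧ Disk ⊆ U ∧ ContDiffOn ℝ (⊤ : ℕ∞) invFun U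
  areaPreserving : ∀ p ∈ Disk,
    (fderiv ℝ toFun p (1, 0)).1 * (fderiv ℝ toFun p (0, 1)).2
      - (fderiv ℝ toFun p (0, 1)).1 * (fderiv ℝ toFun p (1, 0)).2 = 1

/-- `g ∈ H_rel`: the restriction of `g` to the boundary circle is the identity. -/
def IsRel (g : SympD) : Prop := ∀ p ∈ Bdry, g.toFun p = p

/-- `g ∈ G`: `g` fixes the origin. -/
def FixesOrigin (g : SympD) : Prop := g.toFun (0, 0) = (0, 0)

/-- `g ∈ G_rel = G ∩ H_rel`. -/
def IsGrel (g : SympD) : Prop := FixesOrigin g ∧ IsRel g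

/-- `gh` coincides on `D` with the composite `g ∘ h`. -/
def IsComp (g h gh : SympD) : Prop := ∀ p ∈ Disk, gh.toFun p = g.toFun (h.toFun p)

/-- The 1-cochain `τ(g) = ∫_γ (g*η − η) = ∫₀¹ ½(g₁ ∂₁g₂ − g₂ ∂₁g₁)(t,0) dt`,
where `γ(t) = (t,0)` and `η = (x dy − y dx)/2` vanishes along `γ`. -/
def tau (g : SympD) : ℝ :=
  ∫ t in (0:ℝ)..1, (1 / 2) *
    ((g.toFun (t, 0)).1 * (fderiv ℝ g.toFun (t, 0) (1, 0)).2
      - (g.toFun (t, 0)).2 * (fderiv ℝ g.toFun (t, 0) (1, 0)).1)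

/-- `φ : ℝ → ℝ` is a lift of the boundary restriction `g|_{∂D}`. -/
def IsLift (g : SympD) (φ : ℝ → ℝ) : Prop :=
  ContDiff ℝ (⊤ : ℕ∞) φ ∧ (∀ θ : ℝ, φ (θ + 2 * Real.pi) = φ θ + 2 * Real.pi) ∧
    ∀ θ : ℝ, g.toFun (Real.cos θ, Real.sin θ) = (Real.cos (φ θ), Real.sin (φ θ))

/-- `F` is the primitive `F_g` of the closed 1-form `g*η − η` on `D`, normalized by
`F(x₀) = 0` at `x₀ = (1,0)`: it is `C^∞` on a neighborhood of `D` and satisfies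
`dF = g*η − η` at every point of `D`. -/
def IsPrimitive (g : SympD) (F : ℝ × ℝ → ℝ) : Prop :=
  (∃ U : Set (ℝ × ℝ), IsOpen U ∧ Disk ⊆ U ∧ ContDiffOn ℝ (⊤ : ℕ∞) F U) ∧
  (∀ p ∈ Disk, ∀ v : ℝ × ℝ,
    fderiv ℝ F p v =
      (1 / 2) * ((g.toFun p).1 * (fderiv ℝ g.toFun p v).2
        - (g.toFun p).2 * (fderiv ℝ g.toFun p v).1)
      - (1 / 2) * (p.1 * v.2 - p.2 * v.1)) ∧
  F (1, 0) = 0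

/-- `κ(g) = −∫_{∂D} F_g η = −½ ∫₀^{2π} F_g(cos θ, sin θ) dθ`, expressed in terms of a
chosen primitive `F = F_g`. -/
def kappaOf (F : ℝ × ℝ → ℝ) : ℝ :=
  -(1 / 2) * ∫ θ in (0:ℝ)..(2 * Real.pi), F (Real.cos θ, Real.sin θ)

/-- The 1-cochain `τ₀(g) = ∫_D g*η ∧ η
 = ∬_D ¼[(g₁ ∂ₓg₂ − g₂ ∂ₓg₁)x + (g₁ ∂_yg₂ − g₂ ∂_yg₁)y] dx dy`. -/
def tau0 (g : SympD) : ℝ :=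
  ∫ p in Disk, (1 / 4) *
    (((g.toFun p).1 * (fderiv ℝ g.toFun p (1, 0)).2
        - (g.toFun p).2 * (fderiv ℝ g.toFun p (1, 0)).1) * p.1
      + ((g.toFun p).1 * (fderiv ℝ g.toFun p (0, 1)).2
        - (g.toFun p).2 * (fderiv ℝ g.toFun p (0, 1)).1) * p.2)

open Set Filter Topology

/-- The Liouville form as a continuous linear map to covectors. -/
def etaL : (ℝ × ℝ) →L[ℝ] (ℝ × ℝ) →L[ℝ] ℝ :=
  (1 / 2 : ℝ) • ((ContinuousLinearMap.fst ℝ ℝ ℝ).smulRight (ContinuousLinearMap.snd ℝ ℝ ℝ)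
    - (ContinuousLinearMap.snd ℝ ℝ ℝ).smulRight (ContinuousLinearMap.fst ℝ ℝ ℝ))

lemma etaL_apply (p v : ℝ × ℝ) : etaL p v = (1 / 2) * (p.1 * v.2 - p.2 * v.1) := by
  simp [etaL]

lemma convex_Disk : Convex ℝ Disk := by
  intro x hx y hy a b ha hb hab
  simp only [Disk, mem_ofPred_eq, Prod.fst_add, Prod.snd_add, Prod.smul_fst, Prod.smul_snd,
    smul_eq_mul] at *
  have hb' : b = 1 - a := by linarith
  subst hb'
  nlinarith [mul_nonneg (mul_nonneg ha hb) (sq_nonneg (x.1 - y.1)),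
    mul_nonneg (mul_nonneg ha hb) (sq_nonneg (x.2 - y.2)), mul_le_mul_of_nonneg_left hx ha,
    mul_le_mul_of_nonneg_left hy hb]

lemma Disk_mem_nhds {p : ℝ × ℝ} (hp : p.1 ^ 2 + p.2 ^ 2 < 1) : Disk ∈ 𝓝 p := by
  have ho : IsOpen {p : ℝ × ℝ | p.1 ^ 2 + p.2 ^ 2 < 1} :=
    isOpen_lt (by fun_prop) continuous_const
  exact mem_of_superset (ho.mem_nhds hp) (fun q hq => by
    have hq' : q.1 ^ 2 + q.2 ^ 2 < 1 := hq
    exact hq'.le)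

lemma SympD.cd (g : SympD) {p : ℝ × ℝ} (hp : p ∈ Disk) :
    ContDiffAt ℝ (⊤ : ℕ∞) g.toFun p := by
  obtain ⟨U, hU, hD, hs⟩ := g.smooth
  exact hs.contDiffAt (hU.mem_nhds (hD hp))

lemma SympD.cdInv (g : SympD) {p : ℝ × ℝ} (hp : p ∈ Disk) :
    ContDiffAt ℝ (⊤ : ℕ∞) g.invFun p := by
  obtain ⟨U, hU, hD, hs⟩ := g.invSmooth
  exact hs.contDiffAt (hU.mem_nhds (hD hp))

lemma SympD.diff (g : SympD) {p : ℝ × ℝ} (hp : p ∈ Disk) :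
    HasFDerivAt g.toFun (fderiv ℝ g.toFun p) p :=
  ((g.cd hp).differentiableAt (by simp)).hasFDerivAt

lemma SympD.cdFderiv (g : SympD) {p : ℝ × ℝ} (hp : p ∈ Disk) :
    ContDiffAt ℝ 1 (fderiv ℝ g.toFun) p :=
  ContDiffAt.fderiv_right (g.cd hp) (by norm_cast)

/-- The closed form `g*η - η`. -/
def form (g : SympD) (p : ℝ × ℝ) : (ℝ × ℝ) →L[ℝ] ℝ :=
  (etaL (g.toFun p)).comp (fderiv ℝ g.toFun p) - etaL p

lemma det_expand (L : (ℝ × ℝ) →L[ℝ] (ℝ × ℝ)) (u v : ℝ × ℝ) :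
    (L u).1 * (L v).2 - (L u).2 * (L v).1 =
      ((L (1, 0)).1 * (L (0, 1)).2 - (L (0, 1)).1 * (L (1, 0)).2) * (u.1 * v.2 - u.2 * v.1) := by
  have key : ∀ w : ℝ × ℝ, L w = w.1 • L (1, 0) + w.2 • L (0, 1) := by
    intro w
    rw [← L.map_smul, ← L.map_smul, ← L.map_add]
    simp
  rw [key u, key v]
  simp only [Prod.fst_add, Prod.snd_add, Prod.smul_fst, Prod.smul_snd, smul_eq_mul]
  ring

lemma exists_prim (g : SympD) :
    ∃ F : ℝ × ℝ → ℝ, ∀ p ∈ Disk, HasFDerivWithinAt F (form g p) Disk p := by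
  have hd : ∀ x ∈ Disk, HasFDerivAt (form g)
      ((((ContinuousLinearMap.compL ℝ (ℝ × ℝ) (ℝ × ℝ) ℝ) (etaL (g.toFun x))).comp
        (fderiv ℝ (fderiv ℝ g.toFun) x) +
        ((ContinuousLinearMap.compL ℝ (ℝ × ℝ) (ℝ × ℝ) ℝ).flip (fderiv ℝ g.toFun x)).comp
          (etaL.comp (fderiv ℝ g.toFun x))) - etaL) x := by
    intro x hx
    have h1 : HasFDerivAt (fun p => etaL (g.toFun p)) (etaL.comp (fderiv ℝ g.toFun x)) x :=
      etaL.hasFDerivAt.comp x (g.diff hx)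
    have h2 : HasFDerivAt (fderiv ℝ g.toFun) (fderiv ℝ (fderiv ℝ g.toFun) x) x :=
      ((g.cdFderiv hx).differentiableAt (by simp)).hasFDerivAt
    exact (h1.clm_comp h2).sub etaL.hasFDerivAt
  refine convex_Disk.exists_forall_hasFDerivWithinAt_of_hasFDerivWithinAt_symmetric
    (fun x hx => (hd x hx).hasFDerivWithinAt) ?_
  intro a ha x _ y _
  have hs : fderiv ℝ (fderiv ℝ g.toFun) a x y = fderiv ℝ (fderiv ℝ g.toFun) a y x := by
    have := (g.cd ha).isSymmSndFDerivAt (by simp; norm_cast)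
    exact this.eq x y
  have hdet := det_expand (fderiv ℝ g.toFun a) x y
  rw [g.areaPreserving a ha] at hdet
  simp only [_root_.sub_apply, _root_.add_apply,
    ContinuousLinearMap.comp_apply, ContinuousLinearMap.compL_apply,
    ContinuousLinearMap.flip_apply, etaL_apply, hs]
  linear_combination hdet

lemma bdry_maps (g : SympD) {p : ℝ × ℝ} (hp : p ∈ Bdry) : g.toFun p ∈ Bdry := by
  have hpD : p ∈ Disk := le_of_eq hp
  have hqD : g.toFun p ∈ Disk := g.mapsTo hpD
  by_contra hcon
  have hlt : (g.toFun p).1 ^ 2 + (g.toFun p).2 ^ 2 < 1 := lt_of_le_of_ne hqD hcon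
  set q := g.toFun p with hq
  have hinv : g.invFun q = p := g.leftInv p hpD
  have hnh := Disk_mem_nhds hlt
  have hI : HasFDerivAt g.invFun (fderiv ℝ g.invFun q) q :=
    ((g.cdInv hqD).differentiableAt (by simp)).hasFDerivAt
  set L := fderiv ℝ g.invFun q
  have hG : HasFDerivAt g.toFun (fderiv ℝ g.toFun p) (g.invFun q) := by
    rw [hinv]; exact g.diff hpD
  have hc := hG.comp q hI
  have hid : HasFDerivAt (g.toFun ∘ g.invFun) (ContinuousLinearMap.id ℝ (ℝ × ℝ)) q := by
    refine (hasFDerivAt_id q).congr_of_eventuallyEq ?_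
    filter_upwards [hnh] with r hr
    exact g.rightInv r hr
  have heq := hc.unique hid
  have hinj : Function.Injective (L : (ℝ × ℝ) →ₗ[ℝ] (ℝ × ℝ)) := by
    intro u v huv
    have huv' : L u = L v := huv
    have h1 := congrArg (fun T : (ℝ × ℝ) →L[ℝ] (ℝ × ℝ) => T u) heq
    have h2 := congrArg (fun T : (ℝ × ℝ) →L[ℝ] (ℝ × ℝ) => T v) heq
    simp only [ContinuousLinearMap.comp_apply, ContinuousLinearMap.id_apply] at h1 h2
    rw [← h1, ← h2, huv']
  have hsurj := LinearMap.injective_iff_surjective.1 hinj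
  obtain ⟨v, hv⟩ := hsurj p
  have hv' : L v = p := hv
  have hN : HasFDerivAt (fun r => (g.invFun r).1 ^ 2 + (g.invFun r).2 ^ 2)
      _ q := (hI.fst.pow 2).add (hI.snd.pow 2)
  have hmax : IsLocalMax (fun r => (g.invFun r).1 ^ 2 + (g.invFun r).2 ^ 2) q := by
    filter_upwards [hnh] with r hr
    rw [hinv]
    have h1 : (g.invFun r).1 ^ 2 + (g.invFun r).2 ^ 2 ≤ 1 := g.invMapsTo hr
    have h2 : p.1 ^ 2 + p.2 ^ 2 = 1 := hp
    linarith
  have h0 := hmax.hasFDerivAt_eq_zero hN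
  have h1 := congrArg (fun T : (ℝ × ℝ) →L[ℝ] ℝ => T v) h0
  simp [hinv, hv'] at h1
  have h2 : p.1 ^ 2 + p.2 ^ 2 = 1 := hp
  nlinarith

lemma radial_nonneg (g : SympD) {p : ℝ × ℝ} (hp : p ∈ Bdry) :
    0 ≤ (g.toFun p).1 * (fderiv ℝ g.toFun p p).1 + (g.toFun p).2 * (fderiv ℝ g.toFun p p).2 := by
  have hpD : p ∈ Disk := le_of_eq hp
  have hI := g.diff hpD
  have hN : HasFDerivAt (fun r => (g.toFun r).1 ^ 2 + (g.toFun r).2 ^ 2)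
      _ p := (hI.fst.pow 2).add (hI.snd.pow 2)
  have hmax : IsLocalMaxOn (fun r => (g.toFun r).1 ^ 2 + (g.toFun r).2 ^ 2) Disk p := by
    filter_upwards [self_mem_nhdsWithin] with r hr
    have h1 : (g.toFun r).1 ^ 2 + (g.toFun r).2 ^ 2 ≤ 1 := g.mapsTo hr
    have h2 : (g.toFun p).1 ^ 2 + (g.toFun p).2 ^ 2 = 1 := bdry_maps g hp
    linarith
  have hmem : -p ∈ posTangentConeAt Disk p := by
    apply mem_posTangentConeAt_of_segment_subset
    apply convex_Disk.segment_subset hpD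
    simp [Disk]
  have := hmax.hasFDerivWithinAt_nonpos hN.hasFDerivWithinAt hmem
  simp at this
  nlinarith

lemma arc_bound (g : SympD) (F : ℝ × ℝ → ℝ)
    (hF : ∀ p ∈ Disk, HasFDerivWithinAt F (form g p) Disk p) (θ₁ : ℝ) (h0 : 0 ≤ θ₁)
    (h1 : θ₁ < 2 * Real.pi) :
    |F (Real.cos θ₁, Real.sin θ₁) - F (1, 0)| ≤ Real.pi := by
  have hcB : ∀ θ : ℝ, (Real.cos θ, Real.sin θ) ∈ Bdry := fun θ => Real.cos_sq_add_sin_sq θ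
  have hcD : ∀ θ : ℝ, (Real.cos θ, Real.sin θ) ∈ Disk := fun θ => le_of_eq (hcB θ)
  have hc : ∀ θ : ℝ, HasDerivAt (fun θ : ℝ => (Real.cos θ, Real.sin θ))
      (-Real.sin θ, Real.cos θ) θ := fun θ => (Real.hasDerivAt_cos θ).prodMk (Real.hasDerivAt_sin θ)
  set c : ℝ → ℝ × ℝ := fun θ => g.toFun (Real.cos θ, Real.sin θ) with hcdef
  set c' : ℝ → ℝ × ℝ := fun θ =>
    fderiv ℝ g.toFun (Real.cos θ, Real.sin θ) (-Real.sin θ, Real.cos θ) with hc'def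
  have hgc : ∀ θ, HasDerivAt c (c' θ) θ := fun θ =>
    (g.diff (hcD θ)).comp_hasDerivAt θ (hc θ)
  have hone : ∀ θ, (c θ).1 ^ 2 + (c θ).2 ^ 2 = 1 := fun θ => bdry_maps g (hcB θ)
  have hgc1 : ∀ θ, HasDerivAt (fun θ => (c θ).1) (c' θ).1 θ := fun θ => (hgc θ).fst
  have hgc2 : ∀ θ, HasDerivAt (fun θ => (c θ).2) (c' θ).2 θ := fun θ => (hgc θ).snd
  have horth : ∀ θ, (c θ).1 * (c' θ).1 + (c θ).2 * (c' θ).2 = 0 := by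
    intro θ
    have h2 := ((hgc1 θ).pow 2).add ((hgc2 θ).pow 2)
    have h3 : HasDerivAt ((fun θ => (c θ).1) ^ 2 + (fun θ => (c θ).2) ^ 2) 0 θ := by
      have : ((fun θ => (c θ).1) ^ 2 + (fun θ => (c θ).2) ^ 2) = fun _ => (1 : ℝ) := by
        funext θ
        exact hone θ
      rw [this]
      exact hasDerivAt_const θ 1
    have := h2.unique h3
    simp at this
    linarith
  set lam : ℝ → ℝ := fun θ => (c θ).1 * (c' θ).2 - (c θ).2 * (c' θ).1 with hlam
  have hc1 : ∀ θ, (c' θ).1 = - lam θ * (c θ).2 := by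
    intro θ
    simp only [hlam]
    linear_combination (-(c' θ).1) * hone θ + (c θ).1 * horth θ
  have hc2 : ∀ θ, (c' θ).2 = lam θ * (c θ).1 := by
    intro θ
    simp only [hlam]
    linear_combination (-(c' θ).2) * hone θ + (c θ).2 * horth θ
  have hpos : ∀ θ, 0 ≤ lam θ := by
    intro θ
    have hr := radial_nonneg g (hcB θ)
    have hd := det_expand (fderiv ℝ g.toFun (Real.cos θ, Real.sin θ)) (Real.cos θ, Real.sin θ)
      (-Real.sin θ, Real.cos θ)
    rw [g.areaPreserving _ (hcD θ)] at hd
    change 0 ≤ (c θ).1 * _ + (c θ).2 * _ at hr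
    change _ * (c' θ).2 - _ * (c' θ).1 = _ at hd
    rw [hc1, hc2] at hd
    have hcs := Real.cos_sq_add_sin_sq θ
    simp only at hd
    by_contra hneg
    push Not at hneg
    nlinarith [mul_nonneg hr (neg_nonneg.2 hneg.le)]
  set Φ : ℝ → ℝ := fun θ => 2 * (F (Real.cos θ, Real.sin θ) - F (1, 0)) + θ with hΦdef
  have hΦ : ∀ θ, HasDerivAt Φ (lam θ) θ := by
    intro θ
    have h2 : HasDerivAt (fun θ : ℝ => F (Real.cos θ, Real.sin θ))
        (form g (Real.cos θ, Real.sin θ) (-Real.sin θ, Real.cos θ)) θ :=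
      (hF _ (hcD θ)).comp_hasDerivAt θ (hc θ) (Eventually.of_forall hcD)
    have h3 := ((h2.sub_const (F (1, 0))).const_mul 2).add (hasDerivAt_id θ)
    refine h3.congr_deriv ?_
    simp only [form, _root_.sub_apply, ContinuousLinearMap.comp_apply, etaL_apply]
    have hcs := Real.cos_sq_add_sin_sq θ
    simp only [hlam, hc'def, hcdef]
    linear_combination -hcs
  have hΦ0 : Φ 0 = 0 := by simp [hΦdef]
  have hmono : Monotone Φ := monotone_of_hasDerivAt_nonneg hΦ hpos
  have hΦpos : 0 ≤ Φ θ₁ := hΦ0 ▸ hmono h0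
  have hΦle : Φ θ₁ ≤ 2 * Real.pi := by
    by_contra hgt
    push Not at hgt
    have hcont : Continuous Φ := continuous_iff_continuousAt.2 fun θ => (hΦ θ).continuousAt
    obtain ⟨θ, hθ, hθe⟩ := intermediate_value_Ioo h0 hcont.continuousOn
      (show 2 * Real.pi ∈ Ioo (Φ 0) (Φ θ₁) from ⟨by rw [hΦ0]; positivity, hgt⟩)
    have hA : ∀ θ, HasDerivAt (fun θ => (c θ).1 * Real.cos (Φ θ) + (c θ).2 * Real.sin (Φ θ)) 0 θ := by
      intro θ
      have := ((hgc1 θ).mul (hΦ θ).cos).add ((hgc2 θ).mul (hΦ θ).sin)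
      refine this.congr_deriv ?_
      rw [hc1, hc2]; ring
    have hB : ∀ θ, HasDerivAt (fun θ => (c θ).2 * Real.cos (Φ θ) - (c θ).1 * Real.sin (Φ θ)) 0 θ := by
      intro θ
      have := ((hgc2 θ).mul (hΦ θ).cos).sub ((hgc1 θ).mul (hΦ θ).sin)
      refine this.congr_deriv ?_
      rw [hc1, hc2]; ring
    have eA := is_const_of_deriv_eq_zero (fun θ => (hA θ).differentiableAt)
      (fun θ => (hA θ).deriv) θ 0
    have eB := is_const_of_deriv_eq_zero (fun θ => (hB θ).differentiableAt)
      (fun θ => (hB θ).deriv) θ 0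
    simp only [hθe, hΦ0, Real.cos_two_pi, Real.sin_two_pi, Real.cos_zero, Real.sin_zero, mul_one,
      mul_zero, add_zero, sub_zero] at eA eB
    have ec : c θ = c 0 := Prod.ext eA eB
    have e2 : (Real.cos θ, Real.sin θ) = (Real.cos 0, Real.sin 0) := by
      rw [← g.leftInv _ (hcD θ), ← g.leftInv _ (hcD 0)]
      exact congrArg g.invFun ec
    have e3 : Real.cos θ = 1 := by
      have := congrArg Prod.fst e2
      simpa using this
    have := (Real.cos_eq_one_iff_of_lt_of_lt (by linarith [hθ.1, Real.pi_pos])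
      (by linarith [hθ.2])).1 e3
    linarith [hθ.1]
  have hval : F (Real.cos θ₁, Real.sin θ₁) - F (1, 0) = (Φ θ₁ - θ₁) / 2 := by
    simp only [hΦdef]; ring
  rw [hval, abs_le]
  constructor <;> linarith

lemma exists_angle {p : ℝ × ℝ} (hp : p ∈ Bdry) :
    ∃ θ : ℝ, 0 ≤ θ ∧ θ < 2 * Real.pi ∧ p = (Real.cos θ, Real.sin θ) := by
  have hp' : p.1 ^ 2 + p.2 ^ 2 = 1 := hp
  set z : ℂ := ⟨p.1, p.2⟩ with hz
  have hn : ‖z‖ = 1 := by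
    have : ‖z‖ ^ 2 = 1 := by
      rw [Complex.sq_norm, Complex.normSq_apply]
      simp only [hz]; linarith
    nlinarith [norm_nonneg z]
  have hcos : Real.cos z.arg = p.1 := by
    have := Complex.norm_mul_cos_arg z
    rw [hn, one_mul] at this
    exact this
  have hsin : Real.sin z.arg = p.2 := by
    have := Complex.norm_mul_sin_arg z
    rw [hn, one_mul] at this
    exact this
  have hpi := Real.pi_pos
  have l1 := Complex.neg_pi_lt_arg z
  have l2 := Complex.arg_le_pi z
  by_cases h : 0 ≤ z.arg
  · exact ⟨z.arg, h, by linarith, Prod.ext hcos.symm hsin.symm⟩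
  · push Not at h
    refine ⟨z.arg + 2 * Real.pi, by linarith, by linarith, ?_⟩
    rw [Real.cos_add_two_pi, Real.sin_add_two_pi]
    exact Prod.ext hcos.symm hsin.symm

lemma seg_mem {t : ℝ} (ht : t ∈ Icc (0 : ℝ) 1) : ((t, 0) : ℝ × ℝ) ∈ Disk := by
  have : t ^ 2 ≤ 1 := by nlinarith [ht.1, ht.2]
  simpa [Disk] using this

lemma hasDerivAt_seg (t : ℝ) : HasDerivAt (fun t : ℝ => ((t, 0) : ℝ × ℝ)) (1, 0) t :=
  (hasDerivAt_id t).prodMk (hasDerivAt_const t 0)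

lemma tau_int (g : SympD) : IntervalIntegrable (fun t : ℝ => (1 / 2) *
    ((g.toFun (t, 0)).1 * (fderiv ℝ g.toFun (t, 0) (1, 0)).2
      - (g.toFun (t, 0)).2 * (fderiv ℝ g.toFun (t, 0) (1, 0)).1)) volume 0 1 := by
  apply ContinuousOn.intervalIntegrable
  rw [uIcc_of_le zero_le_one]
  intro t ht
  apply ContinuousAt.continuousWithinAt
  have hs : ContinuousAt (fun t : ℝ => ((t, 0) : ℝ × ℝ)) t := (hasDerivAt_seg t).continuousAt
  have h1 : ContinuousAt (fun t : ℝ => g.toFun (t, 0)) t :=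
    ContinuousAt.comp (f := fun t : ℝ => ((t, 0) : ℝ × ℝ)) (g.cd (seg_mem ht)).continuousAt hs
  have h2 : ContinuousAt (fun t : ℝ => fderiv ℝ g.toFun (t, 0)) t :=
    ContinuousAt.comp (f := fun t : ℝ => ((t, 0) : ℝ × ℝ)) (g.cdFderiv (seg_mem ht)).continuousAt hs
  have h3 : ContinuousAt (fun t : ℝ => fderiv ℝ g.toFun (t, 0) (1, 0)) t :=
    h2.clm_apply continuousAt_const
  exact continuousAt_const.mul ((h1.fst.mul h3.snd).sub (h1.snd.mul h3.fst))

lemma prim_comp (g : SympD) (F : ℝ × ℝ → ℝ)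
    (hF : ∀ p ∈ Disk, HasFDerivWithinAt F (form g p) Disk p) (c c' : ℝ → ℝ × ℝ)
    (hc : ∀ t ∈ Icc (0 : ℝ) 1, HasDerivAt c (c' t) t) (hD : ∀ t ∈ Icc (0 : ℝ) 1, c t ∈ Disk)
    (f : ℝ → ℝ) (hf : IntervalIntegrable f volume 0 1)
    (hfe : ∀ t ∈ Ioo (0 : ℝ) 1, f t = form g (c t) (c' t)) :
    ∫ t in (0 : ℝ)..1, f t = F (c 1) - F (c 0) := by
  have hw : ∀ t ∈ Icc (0 : ℝ) 1,
      HasDerivWithinAt (fun t => F (c t)) (form g (c t) (c' t)) (Icc 0 1) t := fun t ht =>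
    (hF _ (hD t ht)).comp_hasDerivWithinAt t (hc t ht).hasDerivWithinAt hD
  refine intervalIntegral.integral_eq_sub_of_hasDerivAt_of_le (f := fun t => F (c t)) zero_le_one
    (fun t ht => (hw t ht).continuousWithinAt) (fun t ht => ?_) hf
  rw [hfe t ht]
  exact (hw t (Ioo_subset_Icc_self ht)).hasDerivAt (Icc_mem_nhds ht.1 ht.2)

/-- `τ` is a quasi-morphism on `G`: `|τ(g ∘ h) − τ(g) − τ(h)| ≤ π`. -/
theorem tau_quasimorphism (g h gh : SympD) (hg : FixesOrigin g) (hh : FixesOrigin h)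
    (hcomp : IsComp g h gh) :
    |tau gh - tau g - tau h| ≤ Real.pi := by
  obtain ⟨F, hF⟩ := exists_prim g
  have e1 : tau g = F (1, 0) - F (0, 0) := by
    refine prim_comp g F hF (fun t => (t, 0)) (fun _ => (1, 0)) (fun t _ => hasDerivAt_seg t)
      (fun t ht => seg_mem ht) _ (tau_int g) (fun t _ => ?_)
    simp [form, etaL_apply]
  have e2 : tau gh - tau h = F (h.toFun (1, 0)) - F (h.toFun (0, 0)) := by
    unfold tau
    rw [← intervalIntegral.integral_sub (tau_int gh) (tau_int h)]
    refine prim_comp g F hF (fun t => h.toFun (t, 0)) (fun t => fderiv ℝ h.toFun (t, 0) (1, 0))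
      (fun t ht => (h.diff (seg_mem ht)).comp_hasDerivAt t (hasDerivAt_seg t))
      (fun t ht => h.mapsTo (seg_mem ht)) _ ((tau_int gh).sub (tau_int h)) (fun t ht => ?_)
    have hm := seg_mem (Ioo_subset_Icc_self ht)
    have hlt : ((t, 0) : ℝ × ℝ).1 ^ 2 + ((t, 0) : ℝ × ℝ).2 ^ 2 < 1 := by
      have := ht.1
      have := ht.2
      simp only
      nlinarith
    have hfd : HasFDerivAt gh.toFun
        ((fderiv ℝ g.toFun (h.toFun (t, 0))).comp (fderiv ℝ h.toFun (t, 0))) (t, 0) := by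
      refine ((g.diff (h.mapsTo hm)).comp _ (h.diff hm)).congr_of_eventuallyEq ?_
      filter_upwards [Disk_mem_nhds hlt] with r hr
      exact hcomp r hr
    rw [hfd.fderiv, hcomp _ hm]
    simp only [form, _root_.sub_apply, ContinuousLinearMap.comp_apply, etaL_apply]
  have hb : h.toFun (1, 0) ∈ Bdry := bdry_maps h (by simp [Bdry])
  obtain ⟨θ, h0, h1, hθ⟩ := exists_angle hb
  have hfin := arc_bound g F hF θ h0 h1
  rw [← hθ] at hfin
  have hh' : h.toFun (0, 0) = (0, 0) := hh
  rw [hh'] at e2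
  have : tau gh - tau g - tau h = F (h.toFun (1, 0)) - F (1, 0) := by linarith
  rw [this]
  exact hfin
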